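/- Let ν be a non-negative measure on the unit sphere S^{n−1}. Then ν is spherically universal on the space ℳ_unc(S^{n−1}) of unconditional measures on S^{n−1} if and only if ν has degree n, i.e. ν_{[n]} ≠ 0. -/

import Mathlib

open MeasureTheory
open scoped ENNReal symmDiff Classical

noncomputable section

/-- The Euclidean (ℓ²) norm on `Fin n → ℝ`. -/
def e2 {n : ℕ} (x : Fin n → ℝ) : ℝ := Real.sqrt (∑ i, (x i) ^ 2)

/-- The unit sphere `S^{n-1}` in `ℝⁿ`. -/
def Sph (n : ℕ) : Set (Fin n → ℝ) := {x | e2 x = 1}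

/-- The set `A_E = {x : xᵢ ≠ 0 ↔ i ∈ E}`. -/
def setA {n : ℕ} (E : Finset (Fin n)) : Set (Fin n → ℝ) := {x | ∀ i, x i ≠ 0 ↔ i ∈ E}

/-- Finite signed Borel measures on `ℝⁿ`. -/
abbrev SM (n : ℕ) := MeasureTheory.SignedMeasure (Fin n → ℝ)

/-- A (finite) measure regarded as a signed measure (junk value `0` if not finite). -/
def toSigned {X : Type*} [MeasurableSpace X] (ρ : Measure X) : SignedMeasure X :=
  if h : IsFiniteMeasure ρ then @Measure.toSignedMeasure X _ ρ h else 0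

/-- Multiplicative convolution of two non-negative measures. -/
def mconvPos {n : ℕ} (ρ σ : Measure (Fin n → ℝ)) : Measure (Fin n → ℝ) :=
  (ρ.prod σ).map (fun p => p.1 * p.2)

/-- Multiplicative convolution `μ ⊛ ν` of two signed measures, via Jordan decomposition. -/
def mconv {n : ℕ} (μ ν : SM n) : SM n :=
  toSigned (mconvPos μ.toJordanDecomposition.posPart ν.toJordanDecomposition.posPart
      + mconvPos μ.toJordanDecomposition.negPart ν.toJordanDecomposition.negPart)
  - toSigned (mconvPos μ.toJordanDecomposition.posPart ν.toJordanDecomposition.negPart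
      + mconvPos μ.toJordanDecomposition.negPart ν.toJordanDecomposition.posPart)

/-- `μ` is integrable: `∫ ‖x‖₂ d|μ| < ∞`. -/
def IntegrableSM {n : ℕ} (μ : SM n) : Prop :=
  ∫⁻ x, ENNReal.ofReal (e2 x) ∂μ.totalVariation < ⊤

/-- `μ` is concentrated on `A`:  `|μ|(Aᶜ) = 0`. -/
def ConcOn {n : ℕ} (μ : SM n) (A : Set (Fin n → ℝ)) : Prop := μ.totalVariation Aᶜ = 0

/-- The multiple reflection `T_E` on `ℝⁿ`. -/
def flipE {n : ℕ} (E : Finset (Fin n)) (x : Fin n → ℝ) : Fin n → ℝ :=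
  fun i => if i ∈ E then -x i else x i

/-- Pushforward of a signed measure under `T_E`. -/
def Tmap {n : ℕ} (E : Finset (Fin n)) (μ : SM n) : SM n := μ.map (flipE E)

def EvenUnder {n : ℕ} (μ : SM n) (E : Finset (Fin n)) : Prop := Tmap E μ = μ
def OddUnder {n : ℕ} (μ : SM n) (E : Finset (Fin n)) : Prop := Tmap E μ = -μ

/-- Orthogonal projection onto the coordinate subspace `H_E`. -/
def projE {n : ℕ} (E : Finset (Fin n)) (x : Fin n → ℝ) : Fin n → ℝ :=
  fun i => if i ∈ E then x i else 0

/-- `P_E(μ)`: pushforward under `projE`. -/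
def Pmap {n : ℕ} (E : Finset (Fin n)) (μ : SM n) : SM n := μ.map (projE E)

/-- `R_E(μ) = μ_E`: restriction to `A_E`. -/
def Rres {n : ℕ} (E : Finset (Fin n)) (μ : SM n) : SM n := μ.restrict (setA E)

/-- Sign vector attached to `b : Fin n → Bool`. -/
def signVec {n : ℕ} (b : Fin n → Bool) : Fin n → ℝ := fun i => if b i then 1 else -1

/-- The measure `δ_J = 2^{-n} ∑_{s ∈ 𝒮ⁿ} σ_J(s) δ_s`. -/
def deltaJ {n : ℕ} (J : Finset (Fin n)) : SM n :=
  ((2 : ℝ) ^ n)⁻¹ •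
    ∑ b : Fin n → Bool,
      (∏ j ∈ J, (if b j then (1 : ℝ) else -1)) • toSigned (Measure.dirac (signVec b))

/-- `𝒥(E; Fe, Fo)`. -/
def JsetE {n : ℕ} (E : Finset (Fin n)) (Fe Fo : Set (Finset (Fin n))) :
    Set (Finset (Fin n)) :=
  {J | J ⊆ E ∧ (∀ F ∈ Fe, Even (J ∩ F).card) ∧ (∀ F ∈ Fo, Odd (J ∩ F).card)}

/-- `𝒥(Fe, Fo) = 𝒥([n]; Fe, Fo)`. -/
def Jset {n : ℕ} (Fe Fo : Set (Finset (Fin n))) : Set (Finset (Fin n)) :=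
  {J | (∀ F ∈ Fe, Even (J ∩ F).card) ∧ (∀ F ∈ Fo, Odd (J ∩ F).card)}

/-- `G` has a representation `G = F₁ Δ … Δ F_m` with each `Fᵢ` drawn from `Fe` or `Fo`,
in which the number of terms drawn from `Fo` is even (`odd = false`) or odd (`odd = true`). -/
def HasRep {n : ℕ} (Fe Fo : Set (Finset (Fin n))) (G : Finset (Fin n)) (odd : Bool) : Prop :=
  ∃ l : List (Finset (Fin n) × Bool),
    (∀ p ∈ l, if p.2 then p.1 ∈ Fo else p.1 ∈ Fe) ∧
    (l.map Prod.fst).foldr (· ∆ ·) ∅ = G ∧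
    (l.countP (fun p => p.2)) % 2 = (if odd then 1 else 0)

/-- The generating pair `(Fe, Fo)` is proper: the even and odd parts of the generated group
are disjoint. -/
def ProperPair {n : ℕ} (Fe Fo : Set (Finset (Fin n))) : Prop :=
  ∀ G : Finset (Fin n), ¬ (HasRep Fe Fo G false ∧ HasRep Fe Fo G true)

/-- `ℳ^int(A; Fe, Fo)`: integrable signed measures concentrated on `A`, even under `T_F`
for `F ∈ Fe` and odd under `T_F` for `F ∈ Fo`. -/
def MclassInt {n : ℕ} (A : Set (Fin n → ℝ)) (Fe Fo : Set (Finset (Fin n))) : Set (SM n) :=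
  {μ | IntegrableSM μ ∧ ConcOn μ A ∧ (∀ F ∈ Fe, EvenUnder μ F) ∧ (∀ F ∈ Fo, OddUnder μ F)}

/-- `ν` is universal on `𝒜`. -/
def Universal {n : ℕ} (ν : SM n) (𝒜 : Set (SM n)) : Prop :=
  ∀ μ ∈ 𝒜, mconv ν μ = 0 → μ = 0

/-- Radial projection of a non-negative measure. -/
def radPos {n : ℕ} (ρ : Measure (Fin n → ℝ)) : Measure (Fin n → ℝ) :=
  (ρ.withDensity fun x => ENNReal.ofReal (e2 x)).map (fun x => (e2 x)⁻¹ • x)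

/-- Radial projection `P_S` of a signed measure. -/
def PS {n : ℕ} (μ : SM n) : SM n :=
  toSigned (radPos μ.toJordanDecomposition.posPart) -
    toSigned (radPos μ.toJordanDecomposition.negPart)

/-- The spherical product `μ ⊛_S ν = P_S(μ ⊛ ν)`. -/
def mconvS {n : ℕ} (μ ν : SM n) : SM n := PS (mconv μ ν)

/-- `ν` is spherically universal on `𝒜`. -/
def SphUniversal {n : ℕ} (ν : SM n) (𝒜 : Set (SM n)) : Prop :=
  ∀ μ ∈ 𝒜, mconvS ν μ = 0 → μ = 0

/-- The unconditional symmetrisation `M_unc`. -/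
def Munc {n : ℕ} (μ : SM n) : SM n := ((2 : ℝ) ^ n)⁻¹ • ∑ E : Finset (Fin n), Tmap E μ

/-- Integral of `f` against a signed measure. -/
def sInt {n : ℕ} (μ : SM n) (f : (Fin n → ℝ) → ℝ) : ℝ :=
  (∫ x, f x ∂μ.toJordanDecomposition.posPart) - ∫ x, f x ∂μ.toJordanDecomposition.negPart

/-- `δ₁ ⊗ μ`: the lifting of `μ` to a measure on `ℝ^{n+1}`, with an extra `0`-th coordinate
carrying a unit atom at `1`. -/
def lift0 {n : ℕ} (μ : SM n) : SM (n + 1) := μ.map (fun x => Fin.cons 1 x)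

/-- Symmetrisation about the origin. -/
def Msym {n : ℕ} (μ : SM n) : SM n := (2 : ℝ)⁻¹ • (μ + μ.map (fun x => -x))

/-- The lifting `L(μ) = P_S(M_sym(δ₁ ⊗ μ))`. -/
def Lift {n : ℕ} (μ : SM n) : SM (n + 1) := PS (Msym (lift0 μ))

open ProbabilityTheory in
/-- Finite exponential moments agreeing near `0` force the complex moment-generating functions to
agree on the corresponding vertical strip. -/
lemma complexMGF_eq_of_lintegral_exp_eq {Ω : Type*} [MeasurableSpace Ω] {μ μ' : Measure Ω}
    {Y : Ω → ℝ} (hY : Measurable Y) {ε : ℝ} (hε : 0 < ε)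
    (h : ∀ s : ℝ, |s| < ε → ∫⁻ x, ENNReal.ofReal (Real.exp (s * Y x)) ∂μ =
      ∫⁻ x, ENNReal.ofReal (Real.exp (s * Y x)) ∂μ')
    (hfin : ∀ s : ℝ, |s| < ε → ∫⁻ x, ENNReal.ofReal (Real.exp (s * Y x)) ∂μ ≠ ⊤)
    {z : ℂ} (hz : |z.re| < ε) : complexMGF Y μ z = complexMGF Y μ' z := by
  have hmeas : ∀ (s : ℝ) (m : Measure Ω),
      AEStronglyMeasurable (fun x => Real.exp (s * Y x)) m := fun s m =>
    (by fun_prop : Measurable fun x => Real.exp (s * Y x)).aestronglyMeasurable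
  have hint : ∀ m : Measure Ω,
      (∀ s : ℝ, |s| < ε → ∫⁻ x, ENNReal.ofReal (Real.exp (s * Y x)) ∂m ≠ ⊤) →
      {z : ℂ | |z.re| < ε} ⊆ {z : ℂ | z.re ∈ interior (integrableExpSet Y m)} := by
    intro m hm z hz
    refine mem_interior.2 ⟨Metric.ball 0 ε, fun s hs => ?_, Metric.isOpen_ball, by simpa using hz⟩
    have hs' : |s| < ε := by simpa using hs
    refine ⟨hmeas s m, ?_⟩
    rw [hasFiniteIntegral_iff_ofReal (Filter.Eventually.of_forall fun x => (Real.exp_pos _).le)]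
    exact lt_top_iff_ne_top.2 (hm s hs')
  have hA := (analyticOnNhd_complexMGF (X := Y) (μ := μ)).mono (hint μ hfin)
  have hB := (analyticOnNhd_complexMGF (X := Y) (μ := μ')).mono
    (hint μ' fun s hs => h s hs ▸ hfin s hs)
  have hconv : IsPreconnected {z : ℂ | |z.re| < ε} := by
    have : {z : ℂ | |z.re| < ε} = Complex.reLm ⁻¹' (Metric.ball (0 : ℝ) ε) := by
      ext z; simp
    rw [this]
    exact ((convex_ball (0 : ℝ) ε).linear_preimage Complex.reLm).isPreconnected
  refine AnalyticOnNhd.eqOn_of_preconnected_of_frequently_eq hA hB hconv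
    (z₀ := 0) (by simpa using hε) ?_ hz
  have hev : ∀ᶠ s : ℝ in nhdsWithin 0 {0}ᶜ, complexMGF Y μ s = complexMGF Y μ' s := by
    refine eventually_nhdsWithin_of_eventually_nhds ?_
    filter_upwards [Metric.ball_mem_nhds (0 : ℝ) hε] with s hs
    have hs' : |s| < ε := by simpa using hs
    rw [complexMGF_ofReal, complexMGF_ofReal, mgf, mgf,
      integral_eq_lintegral_of_nonneg_ae
        (Filter.Eventually.of_forall fun x => (Real.exp_pos _).le) (hmeas s μ),
      integral_eq_lintegral_of_nonneg_ae
        (Filter.Eventually.of_forall fun x => (Real.exp_pos _).le) (hmeas s μ'), h s hs']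
  have htend : Filter.Tendsto (fun s : ℝ => (s : ℂ)) (nhdsWithin 0 {0}ᶜ)
      (nhdsWithin (0 : ℂ) {0}ᶜ) := by
    refine tendsto_nhdsWithin_iff.2 ⟨?_, ?_⟩
    · exact (Complex.continuous_ofReal.tendsto' 0 0 (by simp)).mono_left nhdsWithin_le_nhds
    · filter_upwards [self_mem_nhdsWithin] with s hs
      simpa using hs
  exact htend.frequently hev.frequently

lemma continuous_e2 {n : ℕ} : Continuous (e2 : (Fin n → ℝ) → ℝ) := by
  unfold e2; fun_prop

lemma e2_nonneg {n : ℕ} (x : Fin n → ℝ) : 0 ≤ e2 x := Real.sqrt_nonneg _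

lemma e2_smul {n : ℕ} (c : ℝ) (x : Fin n → ℝ) : e2 (c • x) = |c| * e2 x := by
  simp [e2, mul_pow, ← Finset.mul_sum, Real.sqrt_mul (sq_nonneg c), Real.sqrt_sq_eq_abs]

lemma abs_le_e2 {n : ℕ} (x : Fin n → ℝ) (i : Fin n) : |x i| ≤ e2 x := by
  rw [← Real.sqrt_sq_eq_abs]
  exact Real.sqrt_le_sqrt (Finset.single_le_sum (f := fun i => (x i) ^ 2)
    (fun j _ => sq_nonneg _) (Finset.mem_univ i))

lemma e2_eq_zero {n : ℕ} {x : Fin n → ℝ} (h : e2 x = 0) : x = 0 :=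
  funext fun i => abs_nonpos_iff.1 (h ▸ abs_le_e2 x i)

lemma e2_zero {n : ℕ} : e2 (0 : Fin n → ℝ) = 0 := by simp [e2]

/-- The monomial `∏ |xᵢ|^{aᵢ}` with real exponents. -/
def absMonomial {n : ℕ} (a x : Fin n → ℝ) : ℝ := ∏ i, |x i| ^ a i

lemma absMonomial_nonneg {n : ℕ} (a x : Fin n → ℝ) : 0 ≤ absMonomial a x :=
  Finset.prod_nonneg fun _ _ => Real.rpow_nonneg (abs_nonneg _) _

lemma absMonomial_mul {n : ℕ} (a x y : Fin n → ℝ) :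
    absMonomial a (x * y) = absMonomial a x * absMonomial a y := by
  simp [absMonomial, ← Finset.prod_mul_distrib, abs_mul, Real.mul_rpow]

lemma measurable_absMonomial {n : ℕ} (a : Fin n → ℝ) : Measurable (absMonomial a) := by
  unfold absMonomial; fun_prop

lemma absMonomial_smul {n : ℕ} {a : Fin n → ℝ} (ha : ∑ i, a i = 1) {c : ℝ} (hc : 0 < c)
    (x : Fin n → ℝ) : absMonomial a (c • x) = c * absMonomial a x := by
  simp only [absMonomial, Pi.smul_apply, smul_eq_mul, abs_mul, abs_of_pos hc,
    Real.mul_rpow hc.le (abs_nonneg _), Finset.prod_mul_distrib]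
  rw [← Real.rpow_sum_of_pos hc, ha, Real.rpow_one]

lemma absMonomial_zero {n : ℕ} {a : Fin n → ℝ} (ha : ∑ i, a i = 1) :
    absMonomial a (0 : Fin n → ℝ) = 0 := by
  obtain ⟨i, -, hi⟩ := Finset.exists_ne_zero_of_sum_ne_zero (ha ▸ one_ne_zero)
  exact Finset.prod_eq_zero (Finset.mem_univ i) (by simp [hi])

lemma absMonomial_le_one {n : ℕ} {a x : Fin n → ℝ} (ha : ∀ i, 0 ≤ a i) (hx : e2 x = 1) :
    absMonomial a x ≤ 1 :=
  Finset.prod_le_one (fun _ _ => Real.rpow_nonneg (abs_nonneg _) _) fun i _ =>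
    Real.rpow_le_one (abs_nonneg _) (hx ▸ abs_le_e2 x i) (ha i)

lemma absMonomial_pos {n : ℕ} {E : Finset (Fin n)} {a x : Fin n → ℝ} (ha : ∀ i ∉ E, a i = 0)
    (hx : ∀ i ∈ E, x i ≠ 0) : 0 < absMonomial a x := by
  refine Finset.prod_pos fun i _ => ?_
  by_cases hi : i ∈ E
  · exact Real.rpow_pos_of_pos (abs_pos.2 (hx i hi)) _
  · simp [ha i hi]

lemma measurableSet_setA {n : ℕ} (E : Finset (Fin n)) : MeasurableSet (setA E) := by
  have : setA E = ⋂ i, {x : Fin n → ℝ | x i ≠ 0 ↔ i ∈ E} := by ext; simp [setA]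
  rw [this]
  refine MeasurableSet.iInter fun i => ?_
  have h0 : MeasurableSet {x : Fin n → ℝ | x i = 0} :=
    measurableSet_eq_fun (measurable_pi_apply i) measurable_const
  by_cases hi : i ∈ E
  · simp only [hi, iff_true]
    exact h0.compl
  · simpa [hi] using h0

lemma measurableSet_Sph {n : ℕ} : MeasurableSet (Sph n) :=
  (isClosed_singleton.preimage continuous_e2 : IsClosed (e2 ⁻¹' {1})).measurableSet

/-- The part of the sphere of the open face `A_E` lying in the non-negative orthant. -/
def posFace {n : ℕ} (E : Finset (Fin n)) : Set (Fin n → ℝ) :=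
  {x | x ∈ setA E ∧ e2 x = 1 ∧ ∀ i, 0 ≤ x i}

/-- Logarithmic coordinates on `A_E`, centred so that they are invariant under scaling. -/
def logCoord {n : ℕ} (E : Finset (Fin n)) (x : Fin n → ℝ) : Fin n → ℝ :=
  fun i => if i ∈ E then Real.log (x i) - (∑ j ∈ E, Real.log (x j)) / E.card else 0

/-- Inverse of `logCoord E` on `posFace E`. -/
def expCoord {n : ℕ} (E : Finset (Fin n)) (w : Fin n → ℝ) : Fin n → ℝ :=
  (e2 fun i => if i ∈ E then Real.exp (w i) else 0)⁻¹ •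
    fun i => if i ∈ E then Real.exp (w i) else 0

lemma measurable_logCoord {n : ℕ} (E : Finset (Fin n)) : Measurable (logCoord E) := by
  refine measurable_pi_lambda _ fun i => ?_
  by_cases hi : i ∈ E
  · simp only [logCoord, hi, if_true]; fun_prop
  · simp [logCoord, hi]

lemma measurable_expCoord {n : ℕ} (E : Finset (Fin n)) : Measurable (expCoord E) := by
  have h : Measurable fun (w : Fin n → ℝ) i => if i ∈ E then Real.exp (w i) else 0 := by
    refine measurable_pi_lambda _ fun i => ?_
    by_cases hi : i ∈ E
    · simp only [hi, if_true]; fun_prop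
    · simp [hi]
  exact (continuous_e2.measurable.comp h).inv.smul h

lemma expCoord_logCoord {n : ℕ} {E : Finset (Fin n)} {x : Fin n → ℝ} (hx : x ∈ posFace E) :
    expCoord E (logCoord E x) = x := by
  obtain ⟨hxE, hx1, hx0⟩ := hx
  set c : ℝ := Real.exp ((∑ j ∈ E, Real.log (x j)) / E.card) with hc
  have hcpos : 0 < c := Real.exp_pos _
  have key : (fun i => if i ∈ E then Real.exp (logCoord E x i) else 0) = c⁻¹ • x := by
    funext i
    by_cases hi : i ∈ E
    · have : 0 < x i := lt_of_le_of_ne (hx0 i) (((hxE i).2 hi).symm)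
      simp only [hi, if_true, logCoord, Real.exp_sub, Real.exp_log this, Pi.smul_apply,
        smul_eq_mul, ← hc]
      field_simp
    · have : x i = 0 := by
        by_contra h
        exact hi ((hxE i).1 h)
      simp [hi, this]
  rw [expCoord, key, e2_smul, hx1, abs_of_pos (inv_pos.2 hcpos), smul_smul]
  simp [hcpos.ne']

/-- On `posFace E` a monomial is the exponential of a linear form in the logarithms. -/
lemma absMonomial_eq_exp {n : ℕ} {E : Finset (Fin n)} {a x : Fin n → ℝ}
    (ha : ∀ i ∉ E, a i = 0) (hx : x ∈ posFace E) :
    absMonomial a x = Real.exp (∑ i, a i * Real.log (x i)) := by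
  rw [Real.exp_sum]
  refine Finset.prod_congr rfl fun i _ => ?_
  by_cases hi : i ∈ E
  · have : 0 < x i := lt_of_le_of_ne (hx.2.2 i) (((hx.1 i).2 hi).symm)
    rw [abs_of_pos this, Real.rpow_def_of_pos this, mul_comm]
  · simp [ha i hi]

/-- A finite measure on `posFace E` is determined by its moments against monomials of total degree
one with positive exponents. -/
lemma eq_of_lintegral_absMonomial_posFace {n : ℕ} {E : Finset (Fin n)} (hE : E.Nonempty)
    {α β : Measure (Fin n → ℝ)} [IsFiniteMeasure α] [IsFiniteMeasure β]
    (hα : ∀ᵐ x ∂α, x ∈ posFace E) (hβ : ∀ᵐ x ∂β, x ∈ posFace E)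
    (h : ∀ a : Fin n → ℝ, (∀ i ∈ E, 0 < a i) → (∀ i ∉ E, a i = 0) → ∑ i, a i = 1 →
      ∫⁻ x, ENNReal.ofReal (absMonomial a x) ∂α = ∫⁻ x, ENNReal.ofReal (absMonomial a x) ∂β) :
    α = β := by
  have hm : (0 : ℝ) < E.card := by exact_mod_cast hE.card_pos
  set a₀ : Fin n → ℝ := fun i => if i ∈ E then (E.card : ℝ)⁻¹ else 0 with ha₀
  have ha₀E : ∀ i ∉ E, a₀ i = 0 := fun i hi => by simp [ha₀, hi]
  have ha₀nn : ∀ i, 0 ≤ a₀ i := fun i => by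
    simp only [ha₀]; split_ifs <;> positivity
  have ha₀sum : ∑ i, a₀ i = 1 := by
    simp [ha₀, Finset.sum_ite_mem, hm.ne']
  set φ : (Fin n → ℝ) → ℝ≥0∞ := fun x => ENNReal.ofReal (absMonomial a₀ x) with hφ
  have hφm : Measurable φ := (measurable_absMonomial a₀).ennreal_ofReal
  have hφle : ∀ x ∈ posFace E, φ x ≤ 1 := fun x hx => by
    simpa [hφ] using ENNReal.ofReal_le_ofReal (absMonomial_le_one ha₀nn hx.2.1)
  have hφpos : ∀ x ∈ posFace E, φ x ≠ 0 := fun x hx => by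
    simpa [hφ] using absMonomial_pos ha₀E fun i hi => (hx.1 i).2 hi
  have hfin : ∀ (m : Measure (Fin n → ℝ)) [IsFiniteMeasure m], (∀ᵐ x ∂m, x ∈ posFace E) →
      IsFiniteMeasure (m.withDensity φ) := by
    intro m _ hmE
    refine isFiniteMeasure_withDensity (ne_top_of_le_ne_top (measure_ne_top m Set.univ) ?_)
    calc ∫⁻ x, φ x ∂m ≤ ∫⁻ _, 1 ∂m := lintegral_mono_ae (hmE.mono hφle)
      _ = m Set.univ := by simp
  have := hfin α hα
  have := hfin β hβ
  have hmap : (α.withDensity φ).map (logCoord E) = (β.withDensity φ).map (logCoord E) := by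
    refine Measure.ext_of_charFunDual (funext fun L => ?_)
    set c : Fin n → ℝ := fun i => L (Pi.single i 1) with hc
    set cbar : ℝ := (∑ i ∈ E, c i) / E.card with hcbar
    set b : Fin n → ℝ := fun i => if i ∈ E then c i - cbar else 0 with hb
    have hbsum : ∑ i, b i = 0 := by
      simp only [hb, Finset.sum_ite_mem, Finset.univ_inter, Finset.sum_sub_distrib,
        Finset.sum_const, nsmul_eq_mul, hcbar]
      field_simp
      ring
    set Y : (Fin n → ℝ) → ℝ := fun x => ∑ i, b i * Real.log (x i) with hY
    have hYm : Measurable Y := by simp only [hY]; fun_prop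
    have hLY : ∀ x, L (logCoord E x) = Y x := by
      intro x
      have h1 : L (logCoord E x) = ∑ i, logCoord E x i * c i := by
        conv_lhs => rw [← Finset.univ_sum_single (logCoord E x)]
        rw [map_sum]
        refine Finset.sum_congr rfl fun i _ => ?_
        have : (Pi.single i (logCoord E x i) : Fin n → ℝ) =
            logCoord E x i • Pi.single i (1 : ℝ) := by
          rw [← Pi.single_smul]; simp
        simp [hc, this]
      rw [h1]
      simp only [hY, hb, logCoord, ite_mul, zero_mul, Finset.sum_ite_mem, Finset.univ_inter,
        sub_mul, Finset.sum_sub_distrib, hcbar, ← Finset.mul_sum]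
      congr 1
      · exact Finset.sum_congr rfl fun i _ => mul_comm _ _
      · ring
    set ε : ℝ := (E.card : ℝ)⁻¹ / (1 + ∑ i, |b i|) with hε
    have hSpos : 0 < 1 + ∑ i, |b i| :=
      add_pos_of_pos_of_nonneg one_pos (Finset.sum_nonneg fun _ _ => abs_nonneg _)
    have hεpos : 0 < ε := by positivity
    have hmom : ∀ s : ℝ, |s| < ε → ∃ a : Fin n → ℝ, (∀ i ∈ E, 0 < a i) ∧ (∀ i ∉ E, a i = 0) ∧
        ∑ i, a i = 1 ∧ ∀ m : Measure (Fin n → ℝ), (∀ᵐ x ∂m, x ∈ posFace E) →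
          ∫⁻ x, ENNReal.ofReal (Real.exp (s * Y x)) ∂(m.withDensity φ) =
            ∫⁻ x, ENNReal.ofReal (absMonomial a x) ∂m := by
      intro s hs
      have haE : ∀ i ∉ E, a₀ i + s * b i = 0 := fun i hi => by simp [ha₀, hb, hi]
      refine ⟨fun i => a₀ i + s * b i, fun i hi => ?_, haE, ?_, fun m hmE => ?_⟩
      · have h1 : |b i| ≤ ∑ i, |b i| :=
          Finset.single_le_sum (f := fun i => |b i|) (fun _ _ => abs_nonneg _) (Finset.mem_univ i)
        have h2 : |s| * (1 + ∑ i, |b i|) < (E.card : ℝ)⁻¹ := (lt_div_iff₀ hSpos).1 hs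
        have h3 : -(|s| * |b i|) ≤ s * b i := by rw [← abs_mul]; exact neg_abs_le _
        have h4 : |s| * |b i| ≤ |s| * (1 + ∑ i, |b i|) := by gcongr; linarith
        have h5 : a₀ i = (E.card : ℝ)⁻¹ := by simp [ha₀, hi]
        simp only [h5]; linarith
      · simp [Finset.sum_add_distrib, ← Finset.mul_sum, hbsum, ha₀sum]
      · rw [lintegral_withDensity_eq_lintegral_mul _ hφm (by fun_prop)]
        refine lintegral_congr_ae (hmE.mono fun x hx => ?_)
        simp only [Pi.mul_apply, hφ]
        rw [← ENNReal.ofReal_mul (absMonomial_nonneg _ _), absMonomial_eq_exp ha₀E hx,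
          absMonomial_eq_exp haE hx, ← Real.exp_add]
        simp only [hY, add_mul, Finset.sum_add_distrib, Finset.mul_sum, mul_assoc]
    have hC : ProbabilityTheory.complexMGF Y (α.withDensity φ) Complex.I =
        ProbabilityTheory.complexMGF Y (β.withDensity φ) Complex.I := by
      refine complexMGF_eq_of_lintegral_exp_eq hYm hεpos (fun s hs => ?_) (fun s hs => ?_)
        (by simpa using hεpos)
      · obtain ⟨a, h1, h2, h3, h4⟩ := hmom s hs
        rw [h4 α hα, h4 β hβ, h a h1 h2 h3]
      · obtain ⟨a, h1, h2, h3, h4⟩ := hmom s hs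
        rw [h4 α hα]
        refine ne_top_of_le_ne_top (measure_ne_top α Set.univ) ?_
        calc ∫⁻ x, ENNReal.ofReal (absMonomial a x) ∂α ≤ ∫⁻ _, 1 ∂α :=
              lintegral_mono_ae (hα.mono fun x hx => by
                simpa using ENNReal.ofReal_le_ofReal (absMonomial_le_one (fun i => by
                  by_cases hi : i ∈ E
                  · exact (h1 i hi).le
                  · exact (h2 i hi).ge) hx.2.1))
          _ = α Set.univ := by simp
    have hchar : ∀ m : Measure (Fin n → ℝ), charFunDual (m.map (logCoord E)) L =
        ProbabilityTheory.complexMGF Y m Complex.I := by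
      intro m
      rw [charFunDual_apply, integral_map (measurable_logCoord E).aemeasurable
        (by fun_prop), ProbabilityTheory.complexMGF]
      simp [hLY, mul_comm]
    rw [hchar, hchar, hC]
  have hback : ∀ m : Measure (Fin n → ℝ), (∀ᵐ x ∂m, x ∈ posFace E) →
      ((m.withDensity φ).map (logCoord E)).map (expCoord E) = m.withDensity φ := by
    intro m hmE
    rw [Measure.map_map (measurable_expCoord E) (measurable_logCoord E)]
    have : expCoord E ∘ logCoord E =ᵐ[m.withDensity φ] id :=
      (withDensity_absolutelyContinuous m φ).ae_le (hmE.mono fun x hx => expCoord_logCoord hx)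
    rw [Measure.map_congr this, Measure.map_id]
  have hdens : α.withDensity φ = β.withDensity φ := by
    rw [← hback α hα, ← hback β hβ, hmap]
  rw [← withDensity_inv_same hφm (hα.mono hφpos)
      (Filter.Eventually.of_forall fun x => ENNReal.ofReal_ne_top),
    hdens, withDensity_inv_same hφm (hβ.mono hφpos)
      (Filter.Eventually.of_forall fun x => ENNReal.ofReal_ne_top)]

lemma lintegral_eq_sum_setA {n : ℕ} (α : Measure (Fin n → ℝ)) (f : (Fin n → ℝ) → ℝ≥0∞) :
    ∫⁻ x, f x ∂α = ∑ E : Finset (Fin n), ∫⁻ x in setA E, f x ∂α := by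
  rw [← lintegral_biUnion_finset (fun E _ F _ hEF => ?_) fun E _ => measurableSet_setA E]
  · have : ⋃ E ∈ (Finset.univ : Finset (Finset (Fin n))), setA E = Set.univ := by
      refine Set.eq_univ_of_forall fun x => ?_
      simp only [Finset.mem_univ, Set.iUnion_true, Set.mem_iUnion]
      exact ⟨Finset.univ.filter fun i => x i ≠ 0, fun i => by simp⟩
    rw [this, Measure.restrict_univ]
  · refine Set.disjoint_left.2 fun x hxE hxF => hEF ?_
    ext i
    rw [← hxE i, ← hxF i]

/-- A finite measure on the non-negative part of the sphere is determined by its moments against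
monomials of total degree one. -/
lemma eq_of_lintegral_absMonomial {n : ℕ} {α β : Measure (Fin n → ℝ)}
    [IsFiniteMeasure α] [IsFiniteMeasure β]
    (hα : ∀ᵐ x ∂α, e2 x = 1 ∧ ∀ i, 0 ≤ x i) (hβ : ∀ᵐ x ∂β, e2 x = 1 ∧ ∀ i, 0 ≤ x i)
    (h : ∀ a : Fin n → ℝ, (∀ i, 0 ≤ a i) → ∑ i, a i = 1 →
      ∫⁻ x, ENNReal.ofReal (absMonomial a x) ∂α = ∫⁻ x, ENNReal.ofReal (absMonomial a x) ∂β) :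
    α = β := by
  have hface : ∀ (m : Measure (Fin n → ℝ)), (∀ᵐ x ∂m, e2 x = 1 ∧ ∀ i, 0 ≤ x i) →
      ∀ E, ∀ᵐ x ∂(m.restrict (setA E)), x ∈ posFace E := fun m hm E => by
    filter_upwards [ae_restrict_of_ae hm, ae_restrict_mem (measurableSet_setA E)] with x h1 h2
    exact ⟨h2, h1⟩
  have hempty : ∀ (m : Measure (Fin n → ℝ)), (∀ᵐ x ∂m, e2 x = 1 ∧ ∀ i, 0 ≤ x i) →
      m.restrict (setA ∅) = 0 := fun m hm => by
    rw [← ae_eq_bot, ← Filter.eventually_false_iff_eq_bot]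
    filter_upwards [hface m hm ∅] with x hx
    have : x = 0 := funext fun i => by simpa using hx.1 i
    simpa [this, e2_zero] using hx.2.1
  have key : ∀ E, α.restrict (setA E) = β.restrict (setA E) := by
    intro E
    induction E using WellFoundedGT.induction with
    | ind E ih =>
    rcases E.eq_empty_or_nonempty with rfl | hE
    · rw [hempty α hα, hempty β hβ]
    refine eq_of_lintegral_absMonomial_posFace hE (hface α hα E) (hface β hβ E)
      fun a ha ha0 hsum => ?_
    have hann : ∀ i, 0 ≤ a i := fun i => by
      by_cases hi : i ∈ E
      · exact (ha i hi).le
      · exact (ha0 i hi).ge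
    have hother : ∀ F ∈ Finset.univ.erase E,
        ∫⁻ x in setA F, ENNReal.ofReal (absMonomial a x) ∂α =
          ∫⁻ x in setA F, ENNReal.ofReal (absMonomial a x) ∂β := by
      intro F hF
      by_cases hEF : E ⊆ F
      · rw [ih F (lt_of_le_of_ne hEF (Finset.ne_of_mem_erase hF).symm)]
      · obtain ⟨i, hiE, hiF⟩ := Finset.not_subset.1 hEF
        have hzero : ∀ x ∈ setA F, ENNReal.ofReal (absMonomial a x) = (fun _ => 0) x := by
          intro x hx
          have hxi : x i = 0 := by
            by_contra hne
            exact hiF ((hx i).1 hne)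
          rw [absMonomial, Finset.prod_eq_zero (Finset.mem_univ i), ENNReal.ofReal_zero]
          rw [hxi, abs_zero, Real.zero_rpow (ha i hiE).ne']
        rw [setLIntegral_congr_fun (measurableSet_setA F) hzero,
          setLIntegral_congr_fun (measurableSet_setA F) hzero]
        simp
    have htot := h a hann hsum
    rw [lintegral_eq_sum_setA α, lintegral_eq_sum_setA β,
      ← Finset.add_sum_erase _ _ (Finset.mem_univ E),
      ← Finset.add_sum_erase _ _ (Finset.mem_univ E), Finset.sum_congr rfl hother] at htot
    refine (ENNReal.add_left_inj ?_).1 htot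
    refine ENNReal.sum_ne_top.2 fun F _ => ne_top_of_le_ne_top (measure_ne_top β Set.univ) ?_
    calc ∫⁻ x in setA F, ENNReal.ofReal (absMonomial a x) ∂β
        ≤ ∫⁻ x, ENNReal.ofReal (absMonomial a x) ∂β := setLIntegral_le_lintegral _ _
      _ ≤ ∫⁻ _, 1 ∂β := lintegral_mono_ae (hβ.mono fun x hx => by
          simpa using ENNReal.ofReal_le_ofReal (absMonomial_le_one hann hx.1))
      _ = β Set.univ := by simp
  refine Measure.ext_of_lintegral _ fun f _ => ?_
  rw [lintegral_eq_sum_setA α, lintegral_eq_sum_setA β]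
  exact Finset.sum_congr rfl fun E _ => by rw [key E]

lemma toSigned_eq {X : Type*} [MeasurableSpace X] (ρ : Measure X) [h : IsFiniteMeasure ρ] :
    toSigned ρ = ρ.toSignedMeasure := dif_pos h

lemma add_left_cancel_of_isFiniteMeasure {X : Type*} [MeasurableSpace X]
    {ρ α β : Measure X} [IsFiniteMeasure ρ] (h : ρ + α = ρ + β) : α = β := by
  ext s _
  have := congrArg (fun m : Measure X => m s) h
  simpa [ENNReal.add_right_inj (measure_ne_top ρ s)] using this

lemma posPart_add_eq_negPart_add {X : Type*} [MeasurableSpace X] (α β : Measure X)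
    [IsFiniteMeasure α] [IsFiniteMeasure β] :
    (α.toSignedMeasure - β.toSignedMeasure).toJordanDecomposition.posPart + β =
      (α.toSignedMeasure - β.toSignedMeasure).toJordanDecomposition.negPart + α := by
  rw [← Measure.toSignedMeasure_eq_toSignedMeasure_iff, Measure.toSignedMeasure_add,
    Measure.toSignedMeasure_add, add_comm _ α.toSignedMeasure, ← sub_eq_sub_iff_add_eq_add]
  exact (α.toSignedMeasure - β.toSignedMeasure).toSignedMeasure_toJordanDecomposition

lemma toJordanDecomposition_sub_le {X : Type*} [MeasurableSpace X] (α β : Measure X)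
    [IsFiniteMeasure α] [IsFiniteMeasure β] :
    (α.toSignedMeasure - β.toSignedMeasure).toJordanDecomposition.posPart ≤ α ∧
      (α.toSignedMeasure - β.toSignedMeasure).toJordanDecomposition.negPart ≤ β := by
  rw [Measure.toJordanDecomposition_toSignedMeasure_sub]
  exact ⟨Measure.sub_le, Measure.sub_le⟩

lemma negPart_eq_zero_of_nonneg {X : Type*} [MeasurableSpace X] {ν : SignedMeasure X}
    (h : 0 ≤ ν) : ν.toJordanDecomposition.negPart = 0 := by
  have hν := SignedMeasure.toMeasureOfZeroLE_toSignedMeasure ν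
    ((VectorMeasure.le_restrict_univ_iff_le _ _).2 h)
  have := (toJordanDecomposition_sub_le (ν.toMeasureOfZeroLE Set.univ MeasurableSet.univ
    ((VectorMeasure.le_restrict_univ_iff_le _ _).2 h)) 0).2
  rw [hν, Measure.toSignedMeasure_zero, sub_zero] at this
  exact le_antisymm this (Measure.zero_le _)

lemma measurable_normalize {n : ℕ} : Measurable fun x : Fin n → ℝ => (e2 x)⁻¹ • x :=
  continuous_e2.measurable.inv.smul measurable_id

lemma measurable_ofReal_e2 {n : ℕ} : Measurable fun x : Fin n → ℝ => ENNReal.ofReal (e2 x) :=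
  continuous_e2.measurable.ennreal_ofReal

/-- The positively homogeneous function of degree one extending `g` from the sphere. -/
def homExt {n : ℕ} (g : (Fin n → ℝ) → ℝ≥0∞) (x : Fin n → ℝ) : ℝ≥0∞ :=
  ENNReal.ofReal (e2 x) * g ((e2 x)⁻¹ • x)

lemma measurable_homExt {n : ℕ} {g : (Fin n → ℝ) → ℝ≥0∞} (hg : Measurable g) :
    Measurable (homExt g) :=
  measurable_ofReal_e2.mul (hg.comp measurable_normalize)

lemma homExt_zero {n : ℕ} (g : (Fin n → ℝ) → ℝ≥0∞) : homExt g 0 = 0 := by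
  simp [homExt, e2_zero]

lemma homExt_smul {n : ℕ} (g : (Fin n → ℝ) → ℝ≥0∞) {c : ℝ} (hc : 0 < c) (x : Fin n → ℝ) :
    homExt g (c • x) = ENNReal.ofReal c * homExt g x := by
  have : (c * e2 x)⁻¹ • c • x = (e2 x)⁻¹ • x := by
    rw [smul_smul, mul_inv, mul_right_comm, inv_mul_cancel₀ hc.ne', one_mul]
  rw [homExt, e2_smul, abs_of_pos hc, this, ENNReal.ofReal_mul hc.le, mul_assoc, homExt]

lemma homExt_absMonomial {n : ℕ} {a : Fin n → ℝ} (ha : ∑ i, a i = 1) (x : Fin n → ℝ) :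
    homExt (fun y => ENNReal.ofReal (absMonomial a y)) x = ENNReal.ofReal (absMonomial a x) := by
  rcases (e2_nonneg x).eq_or_lt with h | h
  · rw [e2_eq_zero h.symm, homExt_zero, absMonomial_zero ha, ENNReal.ofReal_zero]
  · rw [homExt, absMonomial_smul ha (inv_pos.2 h), ← ENNReal.ofReal_mul (e2_nonneg x),
      mul_inv_cancel_left₀ h.ne']

lemma lintegral_radPos {n : ℕ} (ρ : Measure (Fin n → ℝ)) {g : (Fin n → ℝ) → ℝ≥0∞}
    (hg : Measurable g) : ∫⁻ x, g x ∂(radPos ρ) = ∫⁻ x, homExt g x ∂ρ := by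
  rw [radPos, lintegral_map hg measurable_normalize,
    lintegral_withDensity_eq_lintegral_mul _ measurable_ofReal_e2
      (by exact hg.comp measurable_normalize)]
  rfl

lemma radPos_add {n : ℕ} (ρ σ : Measure (Fin n → ℝ)) :
    radPos (ρ + σ) = radPos ρ + radPos σ := by
  rw [radPos, withDensity_add_measure, Measure.map_add _ _ measurable_normalize]
  rfl

lemma radPos_mono {n : ℕ} {ρ σ : Measure (Fin n → ℝ)} (h : ρ ≤ σ) : radPos ρ ≤ radPos σ :=
  Measure.map_mono (Measure.le_iff.2 fun s hs => by
    rw [withDensity_apply _ hs, withDensity_apply _ hs]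
    exact lintegral_mono' (Measure.restrict_mono le_rfl h) le_rfl) measurable_normalize

lemma PS_sub_eq_zero_iff {n : ℕ} {α β : Measure (Fin n → ℝ)} [IsFiniteMeasure α]
    [IsFiniteMeasure β] [IsFiniteMeasure (radPos α)] [IsFiniteMeasure (radPos β)] :
    PS (α.toSignedMeasure - β.toSignedMeasure) = 0 ↔ radPos α = radPos β := by
  have hle := toJordanDecomposition_sub_le α β
  have hadd := congrArg radPos (posPart_add_eq_negPart_add α β)
  rw [radPos_add, radPos_add] at hadd
  rw [PS]
  generalize (α.toSignedMeasure - β.toSignedMeasure).toJordanDecomposition.posPart = p at *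
  generalize (α.toSignedMeasure - β.toSignedMeasure).toJordanDecomposition.negPart = q at *
  have := isFiniteMeasure_of_le _ (radPos_mono hle.1)
  have := isFiniteMeasure_of_le _ (radPos_mono hle.2)
  rw [toSigned_eq, toSigned_eq, sub_eq_zero, Measure.toSignedMeasure_eq_toSignedMeasure_iff]
  constructor
  · intro h
    rw [h] at hadd
    exact (add_left_cancel_of_isFiniteMeasure hadd).symm
  · intro h
    rw [h, add_comm, add_comm (radPos q)] at hadd
    exact add_left_cancel_of_isFiniteMeasure hadd

lemma lintegral_mconvPos {n : ℕ} (ρ σ : Measure (Fin n → ℝ)) [SFinite σ]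
    {g : (Fin n → ℝ) → ℝ≥0∞} (hg : Measurable g) :
    ∫⁻ z, g z ∂(mconvPos ρ σ) = ∫⁻ x, ∫⁻ y, g (x * y) ∂σ ∂ρ := by
  have hmul : Measurable fun p : (Fin n → ℝ) × (Fin n → ℝ) => p.1 * p.2 :=
    measurable_fst.mul measurable_snd
  rw [mconvPos, lintegral_map hg hmul, lintegral_prod _ (by exact (hg.comp hmul).aemeasurable)]

instance isFiniteMeasure_mconvPos {n : ℕ} (ρ σ : Measure (Fin n → ℝ)) [IsFiniteMeasure ρ]
    [IsFiniteMeasure σ] : IsFiniteMeasure (mconvPos ρ σ) := by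
  unfold mconvPos; infer_instance

lemma e2_mul_le {n : ℕ} {x y : Fin n → ℝ} (hx : e2 x = 1) (hy : e2 y = 1) :
    e2 (x * y) ≤ 1 := by
  rw [← hy]
  refine Real.sqrt_le_sqrt (Finset.sum_le_sum fun i _ => ?_)
  have h1 : (x i) ^ 2 ≤ 1 := by
    rw [sq_le_one_iff_abs_le_one]
    exact hx ▸ abs_le_e2 x i
  simpa [mul_pow] using mul_le_mul_of_nonneg_right h1 (sq_nonneg (y i))

lemma isFiniteMeasure_radPos_mconvPos {n : ℕ} {ρ σ : Measure (Fin n → ℝ)} [IsFiniteMeasure ρ]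
    [IsFiniteMeasure σ] (hρ : ∀ᵐ x ∂ρ, e2 x = 1) (hσ : ∀ᵐ x ∂σ, e2 x = 1) :
    IsFiniteMeasure (radPos (mconvPos ρ σ)) := by
  constructor
  rw [← lintegral_one, lintegral_radPos _ measurable_const,
    lintegral_mconvPos _ _ (measurable_homExt measurable_const)]
  refine lt_of_le_of_lt (lintegral_mono_ae (hρ.mono fun x hx => ?_) :
    _ ≤ ∫⁻ _, σ Set.univ ∂ρ) (by
      rw [lintegral_const]; exact ENNReal.mul_lt_top (measure_lt_top _ _) (measure_lt_top _ _))
  rw [← lintegral_one]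
  refine lintegral_mono_ae (hσ.mono fun y hy => ?_)
  simpa [homExt] using e2_mul_le hx hy

lemma ConcOn.ae {n : ℕ} {μ : SM n} (h : ConcOn μ (Sph n)) :
    (∀ᵐ x ∂μ.toJordanDecomposition.posPart, e2 x = 1) ∧
      ∀ᵐ x ∂μ.toJordanDecomposition.negPart, e2 x = 1 := by
  rw [ConcOn, SignedMeasure.totalVariation, Measure.add_apply, add_eq_zero] at h
  exact ⟨ae_iff.2 h.1, ae_iff.2 h.2⟩

/-- Vanishing of the spherical product with a non-negative measure, in terms of Jordan parts. -/
lemma mconvS_eq_zero_iff {n : ℕ} {ν μ : SM n} (hν : 0 ≤ ν) (hνS : ConcOn ν (Sph n))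
    (hμS : ConcOn μ (Sph n)) : mconvS ν μ = 0 ↔
      radPos (mconvPos ν.toJordanDecomposition.posPart μ.toJordanDecomposition.posPart) =
        radPos (mconvPos ν.toJordanDecomposition.posPart μ.toJordanDecomposition.negPart) := by
  have h0 : ∀ σ : Measure (Fin n → ℝ), mconvPos (0 : Measure (Fin n → ℝ)) σ = 0 := fun σ => by
    simp [mconvPos]
  have := isFiniteMeasure_radPos_mconvPos hνS.ae.1 hμS.ae.1
  have := isFiniteMeasure_radPos_mconvPos hνS.ae.1 hμS.ae.2
  rw [mconvS, mconv, negPart_eq_zero_of_nonneg hν, h0, h0, add_zero, add_zero, toSigned_eq,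
    toSigned_eq, PS_sub_eq_zero_iff]

lemma flipE_flipE {n : ℕ} (E F : Finset (Fin n)) (x : Fin n → ℝ) :
    flipE E (flipE F x) = flipE (E ∆ F) x := by
  funext i
  by_cases hE : i ∈ E <;> by_cases hF : i ∈ F <;> simp [flipE, Finset.mem_symmDiff, hE, hF]

lemma measurable_flipE {n : ℕ} (E : Finset (Fin n)) : Measurable (flipE E) := by
  refine measurable_pi_lambda _ fun i => ?_
  by_cases hi : i ∈ E
  · simp only [flipE, hi, if_true]; fun_prop
  · simp only [flipE, hi, if_false]; fun_prop

lemma abs_flipE {n : ℕ} (E : Finset (Fin n)) (x : Fin n → ℝ) (i : Fin n) :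
    |flipE E x i| = |x i| := by
  by_cases hi : i ∈ E <;> simp [flipE, hi]

lemma e2_flipE {n : ℕ} (E : Finset (Fin n)) (x : Fin n → ℝ) : e2 (flipE E x) = e2 x := by
  unfold e2
  congr 1
  exact Finset.sum_congr rfl fun i _ => sq_eq_sq_iff_abs_eq_abs _ _ |>.2 (abs_flipE E x i)

lemma sum_flipE {n : ℕ} {M : Type*} [AddCommMonoid M] (G : (Fin n → ℝ) → M)
    (F : Finset (Fin n)) (x : Fin n → ℝ) :
    ∑ E : Finset (Fin n), G (flipE E (flipE F x)) = ∑ E : Finset (Fin n), G (flipE E x) := by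
  simp_rw [flipE_flipE]
  exact Equiv.sum_comp (symmDiff_left_involutive F).toPerm fun E => G (flipE E x)

/-- The coordinatewise absolute value. -/
def absVec {n : ℕ} (x : Fin n → ℝ) : Fin n → ℝ := fun i => |x i|

lemma measurable_absVec {n : ℕ} : Measurable (absVec : (Fin n → ℝ) → _) := by
  unfold absVec; fun_prop

lemma exists_flipE_eq_absVec {n : ℕ} (x : Fin n → ℝ) : ∃ F, flipE F x = absVec x := by
  refine ⟨Finset.univ.filter fun i => x i < 0, funext fun i => ?_⟩
  rcases lt_or_ge (x i) 0 with h | h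
  · simp [flipE, absVec, h, abs_of_neg h]
  · simp [flipE, absVec, not_lt.2 h, abs_of_nonneg h]

/-- An unconditional signed measure vanishes once its Jordan parts have the same image under the
coordinatewise absolute value. -/
lemma eq_zero_of_map_absVec_eq {n : ℕ} {μ : SM n} (hμ : ∀ E, Tmap E μ = μ)
    (h : μ.toJordanDecomposition.posPart.map absVec =
      μ.toJordanDecomposition.negPart.map absVec) : μ = 0 := by
  ext B hB
  set G : (Fin n → ℝ) → ℝ≥0∞ := B.indicator 1
  have hGm : Measurable G := measurable_one.indicator hB
  have hpre : ∀ E, MeasurableSet (flipE E ⁻¹' B) := fun E => measurable_flipE E hB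
  have hGE : ∀ E, Measurable fun z => G (flipE E z) := fun E => hGm.comp (measurable_flipE E)
  have hsum : ∀ m : Measure (Fin n → ℝ), ∑ E : Finset (Fin n), m (flipE E ⁻¹' B) =
      ∫⁻ z, ∑ E : Finset (Fin n), G (flipE E z) ∂(m.map absVec) := by
    intro m
    have hGs : Measurable fun z => ∑ E : Finset (Fin n), G (flipE E z) :=
      Finset.measurable_fun_sum _ fun E _ => hGE E
    rw [lintegral_map hGs measurable_absVec]
    have : ∀ x, ∑ E : Finset (Fin n), G (flipE E (absVec x)) =
        ∑ E : Finset (Fin n), G (flipE E x) := fun x => by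
      obtain ⟨F, hF⟩ := exists_flipE_eq_absVec x
      rw [← hF, sum_flipE]
    simp_rw [this]
    rw [lintegral_finsetSum _ fun E _ => hGE E]
    refine Finset.sum_congr rfl fun E _ => ?_
    rw [← lintegral_indicator_one (hpre E)]
    rfl
  have heq : ∑ E : Finset (Fin n), μ.toJordanDecomposition.posPart (flipE E ⁻¹' B) =
      ∑ E : Finset (Fin n), μ.toJordanDecomposition.negPart (flipE E ⁻¹' B) := by
    rw [hsum, hsum, h]
  have heq' := congrArg ENNReal.toReal heq
  rw [ENNReal.toReal_sum fun E _ => measure_ne_top _ _,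
    ENNReal.toReal_sum fun E _ => measure_ne_top _ _, ← sub_eq_zero,
    ← Finset.sum_sub_distrib] at heq'
  have hterm : ∀ E : Finset (Fin n), (μ.toJordanDecomposition.posPart (flipE E ⁻¹' B)).toReal -
      (μ.toJordanDecomposition.negPart (flipE E ⁻¹' B)).toReal = μ B := fun E => by
    conv_rhs => rw [← hμ E, Tmap, VectorMeasure.map_apply _ (measurable_flipE E) hB,
      SignedMeasure.apply_eq_posPart_real_sub_negPart_real _ (hpre E)]
    rfl
  simpa [hterm] using heq'

lemma lintegral_absMonomial_radPos_mconvPos {n : ℕ} {ρ σ : Measure (Fin n → ℝ)} [SFinite σ]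
    {a : Fin n → ℝ} (ha : ∑ i, a i = 1) :
    ∫⁻ x, ENNReal.ofReal (absMonomial a x) ∂(radPos (mconvPos ρ σ)) =
      (∫⁻ x, ENNReal.ofReal (absMonomial a x) ∂ρ) *
        ∫⁻ x, ENNReal.ofReal (absMonomial a x) ∂σ := by
  have hm : Measurable fun x => ENNReal.ofReal (absMonomial a x) :=
    (measurable_absMonomial a).ennreal_ofReal
  rw [lintegral_radPos _ hm]
  simp_rw [homExt_absMonomial ha]
  rw [lintegral_mconvPos _ _ hm]
  simp_rw [absMonomial_mul, ENNReal.ofReal_mul (absMonomial_nonneg _ _)]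
  simp_rw [lintegral_const_mul _ hm]
  rw [lintegral_mul_const _ hm]

/-- A measure on the sphere charging the open orthants determines, through its product, the
absolute-value image of the other factor. -/
lemma map_absVec_eq_of_radPos_mconvPos_eq {n : ℕ} {ρ σ τ : Measure (Fin n → ℝ)}
    [IsFiniteMeasure ρ] [IsFiniteMeasure σ] [IsFiniteMeasure τ]
    (hρ : ∀ᵐ x ∂ρ, e2 x = 1) (hσ : ∀ᵐ x ∂σ, e2 x = 1) (hτ : ∀ᵐ x ∂τ, e2 x = 1)
    (hρ0 : ρ (setA Finset.univ) ≠ 0)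
    (h : radPos (mconvPos ρ σ) = radPos (mconvPos ρ τ)) : σ.map absVec = τ.map absVec := by
  have hS : ∀ m : Measure (Fin n → ℝ), (∀ᵐ x ∂m, e2 x = 1) →
      ∀ᵐ x ∂(m.map absVec), e2 x = 1 ∧ ∀ i, 0 ≤ x i := by
    intro m hm
    have hmeas : MeasurableSet {x : Fin n → ℝ | e2 x = 1 ∧ ∀ i, 0 ≤ x i} := by
      have hpos : {x : Fin n → ℝ | ∀ i, 0 ≤ x i} = ⋂ i, {x | 0 ≤ x i} := by ext; simp
      have : MeasurableSet {x : Fin n → ℝ | ∀ i, 0 ≤ x i} := hpos ▸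
        MeasurableSet.iInter fun i => measurableSet_le measurable_const (measurable_pi_apply i)
      exact measurableSet_Sph.inter this
    rw [ae_map_iff measurable_absVec.aemeasurable hmeas]
    filter_upwards [hm] with x hx
    refine ⟨?_, fun i => abs_nonneg _⟩
    obtain ⟨F, hF⟩ := exists_flipE_eq_absVec x
    rw [← hF, e2_flipE, hx]
  refine eq_of_lintegral_absMonomial (hS σ hσ) (hS τ hτ) fun a ha hsum => ?_
  have hm : Measurable fun x => ENNReal.ofReal (absMonomial a x) :=
    (measurable_absMonomial a).ennreal_ofReal
  have habs : ∀ x, absMonomial a (absVec x) = absMonomial a x := fun x => by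
    simp [absMonomial, absVec]
  rw [lintegral_map hm measurable_absVec, lintegral_map hm measurable_absVec]
  simp_rw [habs]
  have key := congrArg (fun m => ∫⁻ x, ENNReal.ofReal (absMonomial a x) ∂m) h
  simp only [lintegral_absMonomial_radPos_mconvPos hsum] at key
  refine (ENNReal.mul_right_inj ?_ ?_).1 key
  · intro h0
    rw [lintegral_eq_zero_iff hm] at h0
    refine hρ0 (measure_mono_null (t := {x | ¬ ENNReal.ofReal (absMonomial a x) = 0})
      (fun x hx hx0 => ?_) (ae_iff.1 h0))
    have hpos : 0 < absMonomial a x :=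
      absMonomial_pos (E := Finset.univ) (by simp) fun i hi => (hx i).2 hi
    exact absurd (ENNReal.ofReal_eq_zero.1 hx0) (not_le.2 hpos)
  · refine ne_top_of_le_ne_top (measure_ne_top ρ Set.univ) ?_
    calc ∫⁻ x, ENNReal.ofReal (absMonomial a x) ∂ρ ≤ ∫⁻ _, 1 ∂ρ :=
          lintegral_mono_ae (hρ.mono fun x hx => by
            simpa using ENNReal.ofReal_le_ofReal (absMonomial_le_one ha hx))
      _ = ρ Set.univ := by simp

/-- The `0`-`1` vector with support `E`. -/
def indVec {n : ℕ} (E : Finset (Fin n)) : Fin n → ℝ := fun i => if i ∈ E then 1 else 0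

/-- The spherical projection of the counting measure on the sign changes of those `0`-`1` vectors
whose support satisfies `p`. -/
def vertexMeasure {n : ℕ} (p : Finset (Fin n) → Prop) : Measure (Fin n → ℝ) :=
  ∑ E ∈ Finset.univ.filter p, ∑ F : Finset (Fin n),
    ENNReal.ofReal (e2 (indVec E)) • Measure.dirac (flipE F ((e2 (indVec E))⁻¹ • indVec E))

instance isFiniteMeasure_vertexMeasure {n : ℕ} (p : Finset (Fin n) → Prop) :
    IsFiniteMeasure (vertexMeasure p) := by
  constructor
  simp only [vertexMeasure, Measure.coe_finsetSum, Finset.sum_apply, Measure.smul_apply,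
    measure_univ, smul_eq_mul, mul_one]
  exact ENNReal.sum_lt_top.2 fun E _ => ENNReal.sum_lt_top.2 fun F _ => ENNReal.ofReal_lt_top

lemma lintegral_vertexMeasure {n : ℕ} (p : Finset (Fin n) → Prop) (G : (Fin n → ℝ) → ℝ≥0∞) :
    ∫⁻ x, G x ∂(vertexMeasure p) = ∑ E ∈ Finset.univ.filter p, ∑ F : Finset (Fin n),
      ENNReal.ofReal (e2 (indVec E)) * G (flipE F ((e2 (indVec E))⁻¹ • indVec E)) := by
  simp [vertexMeasure, lintegral_finsetSum_measure, lintegral_smul_measure]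

lemma ae_vertexMeasure {n : ℕ} (p : Finset (Fin n) → Prop) :
    ∀ᵐ x ∂(vertexMeasure p), e2 x = 1 := by
  rw [ae_iff]
  change vertexMeasure p (Sph n)ᶜ = 0
  rw [← lintegral_indicator_one measurableSet_Sph.compl, lintegral_vertexMeasure]
  refine Finset.sum_eq_zero fun E _ => Finset.sum_eq_zero fun F _ => ?_
  rcases (e2_nonneg (indVec E)).eq_or_lt with h | h
  · simp [← h]
  · have : e2 (flipE F ((e2 (indVec E))⁻¹ • indVec E)) = 1 := by
      rw [e2_flipE, e2_smul, abs_of_pos (inv_pos.2 h), inv_mul_cancel₀ h.ne']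
    simp [Sph, this]

lemma map_flipE_vertexMeasure {n : ℕ} (p : Finset (Fin n) → Prop) (E : Finset (Fin n)) :
    (vertexMeasure p).map (flipE E) = vertexMeasure p := by
  refine Measure.ext_of_lintegral _ fun G hG => ?_
  rw [lintegral_map hG (measurable_flipE E), lintegral_vertexMeasure, lintegral_vertexMeasure]
  refine Finset.sum_congr rfl fun E' _ => ?_
  simp_rw [flipE_flipE]
  exact Equiv.sum_comp (symmDiff_right_involutive E).toPerm
    fun F => ENNReal.ofReal (e2 (indVec E')) * G (flipE F ((e2 (indVec E'))⁻¹ • indVec E'))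

lemma even_card_symmDiff_singleton {ι : Type*} [DecidableEq ι] (E : Finset ι) (i : ι) :
    Even (E ∆ {i}).card ↔ ¬ Even E.card := by
  by_cases hi : i ∈ E
  · have : E ∆ {i} = E.erase i := by
      ext j; by_cases hj : j = i <;> simp [Finset.mem_symmDiff, hj, hi]
    rw [this, ← Finset.card_erase_add_one hi, Nat.even_add_one, not_not]
  · have : E ∆ {i} = insert i E := by
      ext j; by_cases hj : j = i <;> simp [Finset.mem_symmDiff, hj, hi]
    rw [this, Finset.card_insert_of_notMem hi, Nat.even_add_one]

/-- The even and odd vertex measures have the same product with a point off the open orthants. -/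
lemma lintegral_homExt_vertexMeasure_even_eq_odd {n : ℕ} {x : Fin n → ℝ} {i : Fin n}
    (hx : x i = 0) (g : (Fin n → ℝ) → ℝ≥0∞) :
    ∫⁻ y, homExt g (x * y) ∂(vertexMeasure fun E => Even E.card) =
      ∫⁻ y, homExt g (x * y) ∂(vertexMeasure fun E => ¬ Even E.card) := by
  have hterm : ∀ E F : Finset (Fin n), ENNReal.ofReal (e2 (indVec E)) *
      homExt g (x * flipE F ((e2 (indVec E))⁻¹ • indVec E)) =
        homExt g (x * flipE F (indVec E)) := by
    intro E F
    rcases (e2_nonneg (indVec E)).eq_or_lt with h | h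
    · have : x * flipE F (indVec E) = 0 := by
        funext i
        simp [flipE, e2_eq_zero h.symm]
      rw [this, homExt_zero, ← h]
      simp
    · have : x * flipE F ((e2 (indVec E))⁻¹ • indVec E) =
          (e2 (indVec E))⁻¹ • (x * flipE F (indVec E)) := by
        funext i
        by_cases hi : i ∈ F <;> simp [flipE, hi, mul_left_comm]
      rw [this, homExt_smul g (inv_pos.2 h), ← mul_assoc, ← ENNReal.ofReal_mul h.le,
        mul_inv_cancel₀ h.ne', ENNReal.ofReal_one, one_mul]
  rw [lintegral_vertexMeasure, lintegral_vertexMeasure]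
  simp_rw [hterm]
  refine Finset.sum_nbij' (fun E => E ∆ {i}) (fun E => E ∆ {i}) (fun E hE => ?_)
    (fun E hE => ?_) (fun E _ => symmDiff_symmDiff_cancel_right _ _)
    (fun E _ => symmDiff_symmDiff_cancel_right _ _) fun E _ => ?_
  · simp only [Finset.mem_filter, Finset.mem_univ, true_and] at hE ⊢
    rwa [even_card_symmDiff_singleton, not_not]
  · simp only [Finset.mem_filter, Finset.mem_univ, true_and] at hE ⊢
    rwa [even_card_symmDiff_singleton]
  · refine Finset.sum_congr rfl fun F _ => congrArg (homExt g) (funext fun j => ?_)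
    by_cases hj : j = i
    · simp [hj, hx]
    · simp [flipE, indVec, Finset.mem_symmDiff, hj]

lemma vertexMeasure_setA_univ_eq_zero_iff {n : ℕ} (hn : 1 ≤ n) (p : Finset (Fin n) → Prop) :
    vertexMeasure p (setA Finset.univ) = 0 ↔ ¬ p Finset.univ := by
  have hpos : 0 < e2 (indVec (Finset.univ : Finset (Fin n))) := by
    have := abs_le_e2 (indVec (Finset.univ : Finset (Fin n))) ⟨0, hn⟩
    simp only [indVec, Finset.mem_univ, if_true, abs_one] at this
    linarith
  rw [← lintegral_indicator_one (measurableSet_setA _), lintegral_vertexMeasure]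
  simp only [Finset.sum_eq_zero_iff, Finset.mem_filter, Finset.mem_univ, true_and, forall_const,
    mul_eq_zero, ENNReal.ofReal_eq_zero]
  constructor
  · intro h hp
    rcases h _ hp ∅ with h1 | h1
    · exact absurd h1 (not_le.2 hpos)
    · rw [Set.indicator_of_mem] at h1
      · simp at h1
      · intro i
        simp [flipE, indVec, hpos.ne']
  · intro hp E hE F
    right
    refine Set.indicator_of_notMem (fun hmem => ?_) _
    have hEu : E = Finset.univ := Finset.eq_univ_of_forall fun i => by
      by_contra hi
      exact (hmem i).2 (Finset.mem_univ i) (by simp [flipE, indVec, hi])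
    exact hp (hEu ▸ hE)

lemma Rres_eq_zero_iff_posPart {n : ℕ} {ν : SM n} (hν : 0 ≤ ν) (E : Finset (Fin n)) :
    Rres E ν = 0 ↔ ν.toJordanDecomposition.posPart (setA E) = 0 := by
  have happ : ∀ B, MeasurableSet B → Rres E ν B =
      ν.toJordanDecomposition.posPart.real (B ∩ setA E) := fun B hB => by
    rw [Rres, VectorMeasure.restrict_apply _ (measurableSet_setA E) hB,
      SignedMeasure.apply_eq_posPart_real_sub_negPart_real _ (hB.inter (measurableSet_setA E)),
      negPart_eq_zero_of_nonneg hν]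
    simp
  constructor
  · intro h
    have := happ Set.univ MeasurableSet.univ
    rw [h, Set.univ_inter, zero_apply] at this
    exact (measureReal_eq_zero_iff).1 this.symm
  · intro h
    ext B hB
    rw [happ B hB, zero_apply, measureReal_eq_zero_iff]
    exact measure_mono_null Set.inter_subset_right h

/-- Theorem: a non-negative measure `ν` on `S^{n-1}` is spherically universal on the
unconditional measures on `S^{n-1}` iff `ν_{[n]} ≠ 0`. -/
theorem stmt5 {n : ℕ} (hn : 1 ≤ n) (ν : SM n) (hconc : ConcOn ν (Sph n)) (hpos : 0 ≤ ν) :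
    SphUniversal ν {μ : SM n | ConcOn μ (Sph n) ∧ ∀ E : Finset (Fin n), Tmap E μ = μ} ↔
      Rres (Finset.univ : Finset (Fin n)) ν ≠ 0 := by
  rw [ne_eq, Rres_eq_zero_iff_posPart hpos]
  constructor
  · intro h h0
    set α : Measure (Fin n → ℝ) := vertexMeasure fun E => Even E.card
    set β : Measure (Fin n → ℝ) := vertexMeasure fun E => ¬ Even E.card
    have hle := toJordanDecomposition_sub_le α β
    have hadd := posPart_add_eq_negPart_add α β
    have hconc' : ConcOn (α.toSignedMeasure - β.toSignedMeasure) (Sph n) := by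
      rw [ConcOn, SignedMeasure.totalVariation, Measure.add_apply, add_eq_zero]
      exact ⟨Measure.absolutelyContinuous_of_le hle.1 (ae_iff.1 (ae_vertexMeasure _)),
        Measure.absolutelyContinuous_of_le hle.2 (ae_iff.1 (ae_vertexMeasure _))⟩
    have hinv : ∀ E, Tmap E (α.toSignedMeasure - β.toSignedMeasure) =
        α.toSignedMeasure - β.toSignedMeasure := by
      intro E
      ext B hB
      have hα : α (flipE E ⁻¹' B) = α B := by
        rw [← Measure.map_apply (measurable_flipE E) hB, map_flipE_vertexMeasure]
      have hβ : β (flipE E ⁻¹' B) = β B := by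
        rw [← Measure.map_apply (measurable_flipE E) hB, map_flipE_vertexMeasure]
      rw [Tmap, VectorMeasure.map_apply _ (measurable_flipE E) hB,
        Measure.toSignedMeasure_sub_apply (measurable_flipE E hB),
        Measure.toSignedMeasure_sub_apply hB, measureReal_def, measureReal_def, hα, hβ]
      rfl
    have hzero : α.toSignedMeasure - β.toSignedMeasure = 0 := by
      refine h _ ⟨hconc', hinv⟩ ((mconvS_eq_zero_iff hpos hconc hconc').2 ?_)
      have hprod : radPos (mconvPos ν.toJordanDecomposition.posPart α) =
          radPos (mconvPos ν.toJordanDecomposition.posPart β) := by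
        refine Measure.ext_of_lintegral _ fun g hg => ?_
        rw [lintegral_radPos _ hg, lintegral_radPos _ hg,
          lintegral_mconvPos _ _ (measurable_homExt hg),
          lintegral_mconvPos _ _ (measurable_homExt hg)]
        have hae : ∀ᵐ x ∂ν.toJordanDecomposition.posPart, x ∉ setA Finset.univ :=
          measure_eq_zero_iff_ae_notMem.1 h0
        refine lintegral_congr_ae (hae.mono fun x hx => ?_)
        obtain ⟨i, hi⟩ : ∃ i, x i = 0 := by
          by_contra! hne
          exact hx fun i => by simp [hne i]
        exact lintegral_homExt_vertexMeasure_even_eq_odd hi g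
      have hmul : Measurable fun p : (Fin n → ℝ) × (Fin n → ℝ) => p.1 * p.2 :=
        measurable_fst.mul measurable_snd
      have hsum := congrArg
        (fun m => radPos (mconvPos ν.toJordanDecomposition.posPart m)) hadd
      simp only [mconvPos, Measure.prod_add, Measure.map_add _ _ hmul, radPos_add] at hsum
      simp only [← mconvPos.eq_1] at hsum
      have := isFiniteMeasure_radPos_mconvPos hconc.ae.1 (ae_vertexMeasure (n := n)
        fun E => ¬ Even E.card)
      rw [hprod, add_comm, add_comm (radPos (mconvPos _
        (α.toSignedMeasure - β.toSignedMeasure).toJordanDecomposition.negPart))] at hsum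
      exact add_left_cancel_of_isFiniteMeasure hsum
    rw [sub_eq_zero, Measure.toSignedMeasure_eq_toSignedMeasure_iff] at hzero
    have hα := vertexMeasure_setA_univ_eq_zero_iff hn fun E => Even E.card
    have hβ := vertexMeasure_setA_univ_eq_zero_iff hn fun E => ¬ Even E.card
    rw [show (vertexMeasure fun E : Finset (Fin n) => Even E.card) = _ from hzero, hβ] at hα
    tauto
  · rintro h0 μ ⟨hμS, hμ⟩ hzero
    refine eq_zero_of_map_absVec_eq hμ (map_absVec_eq_of_radPos_mconvPos_eq hconc.ae.1
      hμS.ae.1 hμS.ae.2 h0 ((mconvS_eq_zero_iff hpos hconc hμS).1 hzero))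

end
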